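/- Fix R > 0, χ₀ > 0, ρ ≥ 2R, and set d = ρ − R. On [R,ρ] define χ(r) = χ₀(r−R)², α(r) = 1 + 2(1+i)χ₀(r−R), β(r) = 1 + (1+i)χ(r)/r, ξ(r) = (r + rχ'(r) + χ(r))/|rα(r)β(r)|², η(r) = (r + rχ'(r) + χ(r) + 2χ(r)χ'(r))/|rβ(r)|², and for a real number λ and continuously differentiable v : [R,ρ] → ℂ set 𝒜_λ(v,v) = ∫_R^ρ (r β(r))^{-1} ( α(r)^{-1} |v'(r)|² − λ α(r) |v(r)|² ) dr. There exists a constant C₀ > 0 (independent of λ, χ₀ and ρ) such that whenever λ < 0 and v : [R,ρ] → ℂ is continuously differentiable with v(R) = 0 and v(ρ) = 0, one has Re 𝒜_λ(v,v) ≥ ∫_R^ρ ξ(r)|v'(r)|² dr − C₀ λ ∫_R^ρ η(r)|v(r)|² dr. -/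

import Mathlib

noncomputable section

/-- The quadratic PML absorbing profile `χ(r) = χ₀(r−R)²`. -/
def pmlChi (χ₀ R r : ℝ) : ℝ := χ₀ * (r - R) ^ 2

/-- Its derivative `χ'(r) = 2χ₀(r−R)`. -/
def pmlChi' (χ₀ R r : ℝ) : ℝ := 2 * χ₀ * (r - R)

/-- `α(r) = 1 + 2(1+i)χ₀(r−R)`, the derivative of the complex stretching. -/
def pmlAlpha (χ₀ R r : ℝ) : ℂ := 1 + 2 * (1 + Complex.I) * ((χ₀ * (r - R) : ℝ) : ℂ)

/-- `β(r) = 1 + (1+i)χ(r)/r`. -/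
def pmlBeta (χ₀ R r : ℝ) : ℂ := 1 + (1 + Complex.I) * ((pmlChi χ₀ R r : ℝ) : ℂ) / (r : ℂ)

/-- The real weight `ξ(r) = (r + rχ'(r) + χ(r))/|rα(r)β(r)|²`. -/
def pmlXi (χ₀ R r : ℝ) : ℝ :=
  (r + r * pmlChi' χ₀ R r + pmlChi χ₀ R r) /
    ‖(r : ℂ) * pmlAlpha χ₀ R r * pmlBeta χ₀ R r‖ ^ 2

/-- The real weight `η(r) = (r + rχ'(r) + χ(r) + 2χ(r)χ'(r))/|rβ(r)|²`. -/
def pmlEta (χ₀ R r : ℝ) : ℝ :=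
  (r + r * pmlChi' χ₀ R r + pmlChi χ₀ R r + 2 * pmlChi χ₀ R r * pmlChi' χ₀ R r) /
    ‖(r : ℂ) * pmlBeta χ₀ R r‖ ^ 2

/-- The real weight `ξ₁(r) = (rχ'(r) + χ(r) + 2χ(r)χ'(r))/|rα(r)β(r)|²`. -/
def pmlXi1 (χ₀ R r : ℝ) : ℝ :=
  (r * pmlChi' χ₀ R r + pmlChi χ₀ R r + 2 * pmlChi χ₀ R r * pmlChi' χ₀ R r) /
    ‖(r : ℂ) * pmlAlpha χ₀ R r * pmlBeta χ₀ R r‖ ^ 2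

/-- The real weight `η₁(r) = (rχ'(r) − χ(r))/|rβ(r)|²`. -/
def pmlEta1 (χ₀ R r : ℝ) : ℝ :=
  (r * pmlChi' χ₀ R r - pmlChi χ₀ R r) / ‖(r : ℂ) * pmlBeta χ₀ R r‖ ^ 2

/-- The PML sesquilinear (quadratic) form
`𝒜_λ(v,v) = ∫_R^ρ (rβ)⁻¹ (α⁻¹|v'|² − λα|v|²) dr`. -/
def pmlForm (χ₀ R ρ lam : ℝ) (v v' : ℝ → ℂ) : ℂ :=
  ∫ r in R..ρ, ((r : ℂ) * pmlBeta χ₀ R r)⁻¹ *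
    ((pmlAlpha χ₀ R r)⁻¹ * ((‖v' r‖ ^ 2 : ℝ) : ℂ) -
      (lam : ℂ) * pmlAlpha χ₀ R r * ((‖v r‖ ^ 2 : ℝ) : ℂ))

end

theorem ofReal_mul_pmlBeta (χ₀ R : ℝ) {r : ℝ} (hr : r ≠ 0) :
    (r : ℂ) * pmlBeta χ₀ R r = ⟨r + pmlChi χ₀ R r, pmlChi χ₀ R r⟩ := by
  have hr' : (r : ℂ) ≠ 0 := by exact_mod_cast hr
  have h : (r : ℂ) * pmlBeta χ₀ R r = r + (1 + Complex.I) * (pmlChi χ₀ R r : ℝ) := by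
    rw [pmlBeta]
    field_simp
  rw [h]
  apply Complex.ext <;> simp

theorem pmlAlpha_eq (χ₀ R r : ℝ) :
    pmlAlpha χ₀ R r = ⟨1 + pmlChi' χ₀ R r, pmlChi' χ₀ R r⟩ := by
  apply Complex.ext <;> simp [pmlAlpha, pmlChi'] <;> ring

theorem re_inv_eq_pmlXi (χ₀ R : ℝ) {r : ℝ} (hr : r ≠ 0) :
    (((r : ℂ) * pmlBeta χ₀ R r)⁻¹ * (pmlAlpha χ₀ R r)⁻¹).re = pmlXi χ₀ R r := by
  rw [pmlXi, mul_right_comm, ← mul_inv, Complex.inv_re, Complex.normSq_eq_norm_sq]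
  congr 1
  rw [ofReal_mul_pmlBeta χ₀ R hr, pmlAlpha_eq, Complex.mul_re]
  ring

theorem re_inv_mul_eq_pmlEta (χ₀ R : ℝ) {r : ℝ} (hr : r ≠ 0) :
    (((r : ℂ) * pmlBeta χ₀ R r)⁻¹ * pmlAlpha χ₀ R r).re = pmlEta χ₀ R r := by
  rw [pmlEta, Complex.mul_re, Complex.inv_re, Complex.inv_im, ← Complex.normSq_eq_norm_sq,
    div_mul_eq_mul_div, div_mul_eq_mul_div, ← sub_div]
  congr 1
  rw [ofReal_mul_pmlBeta χ₀ R hr, pmlAlpha_eq]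
  ring

theorem ofReal_mul_pmlBeta_ne_zero {χ₀ R r : ℝ} (hχ : 0 < χ₀) (hr : 0 < r) :
    (r : ℂ) * pmlBeta χ₀ R r ≠ 0 := by
  rw [ofReal_mul_pmlBeta χ₀ R hr.ne']
  intro h
  have h1 : r + pmlChi χ₀ R r = 0 := congrArg Complex.re h
  have h2 : 0 ≤ pmlChi χ₀ R r := by unfold pmlChi; positivity
  linarith

theorem pmlAlpha_ne_zero (χ₀ R r : ℝ) : pmlAlpha χ₀ R r ≠ 0 := by
  rw [pmlAlpha_eq]
  intro h
  have h1 : 1 + pmlChi' χ₀ R r = 0 := congrArg Complex.re h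
  have h2 : pmlChi' χ₀ R r = 0 := congrArg Complex.im h
  linarith

theorem continuous_pmlAlpha (χ₀ R : ℝ) : Continuous (pmlAlpha χ₀ R) := by
  unfold pmlAlpha
  fun_prop

theorem continuousOn_ofReal_mul_pmlBeta (χ₀ R : ℝ) :
    ContinuousOn (fun r : ℝ => (r : ℂ) * pmlBeta χ₀ R r) (Set.Ioi 0) := by
  unfold pmlBeta pmlChi
  have h : ∀ r ∈ Set.Ioi (0 : ℝ), (r : ℂ) ≠ 0 := fun r hr => by
    exact_mod_cast (Set.mem_Ioi.1 hr).ne'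
  fun_prop (disch := assumption)

/-- The real part of the PML form is the weighted energy with weights `ξ` and `-λη`. -/
theorem re_pmlForm {χ₀ R ρ : ℝ} (hR : 0 < R) (hχ : 0 < χ₀) (hρ : R ≤ ρ) (lam : ℝ)
    {v v' : ℝ → ℂ} (hv : ContinuousOn v (Set.Icc R ρ)) (hv' : ContinuousOn v' (Set.Icc R ρ)) :
    (pmlForm χ₀ R ρ lam v v').re =
      (∫ r in R..ρ, pmlXi χ₀ R r * ‖v' r‖ ^ 2) -
        lam * ∫ r in R..ρ, pmlEta χ₀ R r * ‖v r‖ ^ 2 := by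
  have hpos : ∀ r ∈ Set.Icc R ρ, 0 < r := fun r hr => hR.trans_le hr.1
  have hβ : ContinuousOn (fun r : ℝ => ((r : ℂ) * pmlBeta χ₀ R r)⁻¹) (Set.Icc R ρ) :=
    ((continuousOn_ofReal_mul_pmlBeta χ₀ R).mono hpos).inv₀
      fun r hr => ofReal_mul_pmlBeta_ne_zero hχ (hpos r hr)
  have hα : ContinuousOn (pmlAlpha χ₀ R) (Set.Icc R ρ) := (continuous_pmlAlpha χ₀ R).continuousOn
  have hα' : ContinuousOn (fun r => (pmlAlpha χ₀ R r)⁻¹) (Set.Icc R ρ) :=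
    hα.inv₀ fun r _ => pmlAlpha_ne_zero χ₀ R r
  have hξ : ContinuousOn (pmlXi χ₀ R) (Set.Icc R ρ) :=
    (Complex.continuous_re.comp_continuousOn (hβ.mul hα')).congr
      fun r hr => (re_inv_eq_pmlXi χ₀ R (hpos r hr).ne').symm
  have hη : ContinuousOn (pmlEta χ₀ R) (Set.Icc R ρ) :=
    (Complex.continuous_re.comp_continuousOn (hβ.mul hα)).congr
      fun r hr => (re_inv_mul_eq_pmlEta χ₀ R (hpos r hr).ne').symm
  have hint : IntervalIntegrable (fun r : ℝ => ((r : ℂ) * pmlBeta χ₀ R r)⁻¹ *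
      ((pmlAlpha χ₀ R r)⁻¹ * ((‖v' r‖ ^ 2 : ℝ) : ℂ) -
        (lam : ℂ) * pmlAlpha χ₀ R r * ((‖v r‖ ^ 2 : ℝ) : ℂ))) MeasureTheory.volume R ρ :=
    ContinuousOn.intervalIntegrable_of_Icc hρ (by fun_prop)
  have hintξ : IntervalIntegrable (fun r => pmlXi χ₀ R r * ‖v' r‖ ^ 2)
      MeasureTheory.volume R ρ :=
    ContinuousOn.intervalIntegrable_of_Icc hρ (by fun_prop)
  have hintη : IntervalIntegrable (fun r => pmlEta χ₀ R r * ‖v r‖ ^ 2)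
      MeasureTheory.volume R ρ :=
    ContinuousOn.intervalIntegrable_of_Icc hρ (by fun_prop)
  rw [pmlForm, ← intervalIntegral.integral_const_mul,
    ← intervalIntegral.integral_sub hintξ (hintη.const_mul lam), ← Complex.reCLM_apply,
    ← Complex.reCLM.intervalIntegral_comp_comm hint]
  refine intervalIntegral.integral_congr fun r hr => ?_
  rw [Set.uIcc_of_le hρ] at hr
  have hr0 := (hpos r hr).ne'
  simp only [Complex.reCLM_apply]
  rw [← re_inv_eq_pmlXi χ₀ R hr0, ← re_inv_mul_eq_pmlEta χ₀ R hr0, ← Complex.re_mul_ofReal,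
    ← Complex.re_mul_ofReal, ← Complex.re_ofReal_mul, ← Complex.sub_re]
  congr 1
  ring

/-- For evanescent modes (`λ < 0`), the real part of the PML
quadratic form satisfies
`Re 𝒜_λ(v,v) ≥ ∫ ξ|v'|² − C₀ λ ∫ η|v|²` for a constant `C₀ > 0` independent of
`λ`, `χ₀` and `ρ`, for all C¹ functions `v` vanishing at both endpoints. -/
theorem stmt5 (R : ℝ) (hR : 0 < R) :
    ∃ C₀ : ℝ, 0 < C₀ ∧ ∀ χ₀ : ℝ, 0 < χ₀ → ∀ ρ : ℝ, 2 * R ≤ ρ →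
      ∀ lam : ℝ, lam < 0 → ∀ v v' : ℝ → ℂ,
        (∀ r ∈ Set.Icc R ρ, HasDerivAt v (v' r) r) →
        ContinuousOn v' (Set.Icc R ρ) →
        v R = 0 → v ρ = 0 →
        (pmlForm χ₀ R ρ lam v v').re ≥
          (∫ r in R..ρ, pmlXi χ₀ R r * ‖v' r‖ ^ 2) -
            C₀ * lam * ∫ r in R..ρ, pmlEta χ₀ R r * ‖v r‖ ^ 2 := by
  refine ⟨1, one_pos, fun χ₀ hχ ρ hρ lam _ v v' hv hv' _ _ => ?_⟩
  rw [one_mul, re_pmlForm hR hχ (by linarith) lam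
    (fun r hr => (hv r hr).continuousAt.continuousWithinAt) hv']
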